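/- Let G be a finite directed graph (loops allowed) whose out-degree excess satisfies ∑_v max(outdeg(v) − 1, 0) ≤ t (equivalently, G is obtained from a graph in which every vertex has exactly one outgoing edge by adding at most t edges; every t-path graph has this form). Then for every vertex v and every integer l ≥ 1, the number of simple paths of length l in G starting at v is at most (1 + t/l)^l, and hence at most e^t. -/

import Mathlib

open Finset

noncomputable section
open scoped Classical

/-- The out-degree of `v` in the directed graph with edge relation `E` (loops allowed). -/
def outDeg {V : Type*} [Fintype V] (E : V → V → Prop) (v : V) : ℕ :=
  (Finset.univ.filter (fun u => E v u)).card

/-- The number of simple paths of length `l` starting at `v`: tuples of `l+1` pairwise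
distinct vertices beginning with `v`, each consecutive pair joined by an edge. -/
def simplePathCount {V : Type*} [Fintype V] (E : V → V → Prop) (l : ℕ) (v : V) : ℕ :=
  (Finset.univ.filter (fun c : Fin (l + 1) → V =>
      c 0 = v ∧ Function.Injective c ∧
        ∀ k : Fin l, E (c k.castSucc) (c k.succ))).card

lemma simplePathCount_zero_le {V : Type*} [Fintype V] (E : V → V → Prop) (v : V) :
    simplePathCount E 0 v ≤ 1 := by
  refine Finset.card_le_one.2 fun a ha b hb => ?_
  simp only [Finset.mem_filter] at ha hb
  funext i
  rw [Fin.fin_one_eq_zero i, ha.2.1, hb.2.1]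

/-- A simple path starting at `v` uses no further edge out of `v` after its first step. -/
lemma simplePathCount_succ_le {V : Type*} [Fintype V] (E : V → V → Prop) (l : ℕ) (v : V) :
    simplePathCount E (l + 1) v ≤
      ∑ u ∈ Finset.univ.filter (fun u => E v u),
        simplePathCount (fun a b => a ≠ v ∧ E a b) l u := by
  unfold simplePathCount
  refine le_trans ?_ Finset.card_biUnion_le
  refine Finset.card_le_card_of_injOn Fin.tail ?_ ?_
  · intro c hc
    simp only [Finset.coe_filter, Finset.mem_univ, true_and, Set.mem_ofPred_eq] at hc
    obtain ⟨h0, hinj, hE⟩ := hc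
    simp only [Finset.coe_biUnion, Set.mem_iUnion, Finset.coe_filter, Finset.mem_univ, true_and,
      Set.mem_ofPred_eq]
    refine ⟨c 1, ?_, rfl, hinj.comp (Fin.succ_injective _), fun k => ⟨?_, hE k.succ⟩⟩
    · simpa [h0] using hE 0
    · rw [← h0]
      exact hinj.ne (Fin.succ_ne_zero _)
  · intro c hc d hd h
    simp only [Finset.coe_filter, Finset.mem_univ, true_and, Set.mem_ofPred_eq] at hc hd
    rw [← Fin.cons_self_tail c, ← Fin.cons_self_tail d, h, hc.1, hd.1]

lemma sum_excess_remove_add_le {V : Type*} [Fintype V] (E : V → V → Prop) (v : V) :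
    ∑ w, (outDeg (fun a b => a ≠ v ∧ E a b) w - 1) + (outDeg E v - 1) ≤
      ∑ w, (outDeg E w - 1) := by
  rw [← Finset.add_sum_erase _ _ (Finset.mem_univ v),
    ← Finset.add_sum_erase _ (fun w => outDeg E w - 1) (Finset.mem_univ v)]
  have hv : outDeg (fun a b => a ≠ v ∧ E a b) v = 0 := by simp [outDeg]
  have hle : ∑ w ∈ Finset.univ.erase v, (outDeg (fun a b => a ≠ v ∧ E a b) w - 1) ≤
      ∑ w ∈ Finset.univ.erase v, (outDeg E w - 1) := by
    refine Finset.sum_le_sum fun w _ => Nat.sub_le_sub_right (Finset.card_le_card ?_) 1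
    intro u hu
    simp only [Finset.mem_filter] at hu ⊢
    exact ⟨hu.1, hu.2.2⟩
  omega

/-- The inequality of arithmetic and geometric means for one number `d` and `n` copies of
`1 + s / n`. -/
lemma mul_one_add_div_pow_le (n : ℕ) {d s : ℝ} (hd : 0 ≤ d) (hs : 0 ≤ s) :
    d * (1 + s / n) ^ n ≤ ((n + s + d) / (n + 1)) ^ (n + 1) := by
  rcases Nat.eq_zero_or_pos n with rfl | hn
  · simpa using hs
  have hn' : (0 : ℝ) < n := by exact_mod_cast hn
  set x : ℝ := 1 + s / n with hx
  have hx0 : 0 < x := by positivity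
  have hnx : n * x = n + s := by rw [hx]; field_simp
  set A : ℝ := (n + s + d) / (n + 1) with hA
  have hA0 : 0 ≤ A := by positivity
  have hAn : (n + 1) * A = n * x + d := by rw [hnx, hA]; field_simp
  have hb := one_add_mul_le_pow (a := A / x - 1)
    (by have : 0 ≤ A / x := by positivity
        linarith) (n + 1)
  have he : 1 + ((n + 1 : ℕ) : ℝ) * (A / x - 1) = d / x := by
    push_cast
    field_simp
    linarith
  rw [he, add_sub_cancel, div_pow, div_le_div_iff₀ hx0 (by positivity), pow_succ x,
    ← mul_assoc] at hb
  exact le_of_mul_le_mul_right hb hx0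

lemma simplePathCount_le_one_add_div_pow {V : Type*} [Fintype V] (l : ℕ) :
    ∀ (E : V → V → Prop) (t : ℕ), ∑ v, (outDeg E v - 1) ≤ t → ∀ v : V,
      (simplePathCount E l v : ℝ) ≤ (1 + (t : ℝ) / l) ^ l := by
  induction l with
  | zero =>
    intro E t _ v
    simpa using simplePathCount_zero_le E v
  | succ n ih =>
    intro E t hT v
    have hcount := simplePathCount_succ_le E n v
    have hexc := sum_excess_remove_add_le E v
    rcases Nat.eq_zero_or_pos (outDeg E v) with hd | hd
    · rw [Finset.card_eq_zero.1 hd, Finset.sum_empty] at hcount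
      rw [Nat.le_zero.1 hcount, Nat.cast_zero]
      positivity
    obtain ⟨s, hs⟩ : ∃ s, s + outDeg E v = t + 1 := ⟨t + 1 - outDeg E v, by omega⟩
    have hs' : (s : ℝ) + outDeg E v = t + 1 := by exact_mod_cast hs
    calc (simplePathCount E (n + 1) v : ℝ)
        ≤ ∑ u ∈ Finset.univ.filter (fun u => E v u),
            (simplePathCount (fun a b => a ≠ v ∧ E a b) n u : ℝ) := by exact_mod_cast hcount
      _ ≤ ∑ _u ∈ Finset.univ.filter (fun u => E v u), (1 + (s : ℝ) / n) ^ n :=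
          Finset.sum_le_sum fun u _ => ih _ s (by omega) u
      _ = outDeg E v * (1 + (s : ℝ) / n) ^ n := by
          rw [Finset.sum_const, nsmul_eq_mul, outDeg]
      _ ≤ ((n + s + outDeg E v) / (n + 1)) ^ (n + 1) :=
          mul_one_add_div_pow_le n (Nat.cast_nonneg _) (Nat.cast_nonneg _)
      _ = (1 + (t : ℝ) / (n + 1 : ℕ)) ^ (n + 1) := by
          rw [add_assoc, hs']
          push_cast
          congr 1
          field_simp
          ring

/-- In a finite directed graph whose out-degree excess satisfies
`∑_v max(outdeg v - 1, 0) ≤ t`, the number of simple paths of length `l` from any fixed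
vertex is at most `(1 + t/l)^l`, and hence at most `e^t`. -/
theorem simple_path_count_bound
    (V : Type*) [Fintype V] (E : V → V → Prop)
    (t : ℕ) (hT : ∑ v : V, (outDeg E v - 1) ≤ t)
    (v : V) (l : ℕ) (hl : 1 ≤ l) :
    (simplePathCount E l v : ℝ) ≤ (1 + (t : ℝ) / (l : ℝ)) ^ l ∧
      (simplePathCount E l v : ℝ) ≤ Real.exp t := by
  have h := simplePathCount_le_one_add_div_pow l E t hT v
  refine ⟨h, h.trans ?_⟩
  have hl' : (l : ℝ) ≠ 0 := by positivity
  calc (1 + (t : ℝ) / l) ^ l ≤ Real.exp (t / l) ^ l := by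
        gcongr
        linarith [Real.add_one_le_exp ((t : ℝ) / l)]
    _ = Real.exp t := by rw [← Real.exp_nat_mul, mul_div_cancel₀ _ hl']
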